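/- (Decontraction Lemma for SMP) Let G be a graph on vertices {1,…,n}, let A ∈ S(G) have the Strong Multiplicity Property, and let N_G(n) = α ⊔ β be a partition of the neighborhood of vertex n in G. Let H be the graph on vertices {1,…,n+1} whose edges are: all edges of G not incident to n, the edges {n, j} for j ∈ α, the edges {n+1, j} for j ∈ β, and the edge {n, n+1} (so that contracting the edge {n, n+1} of H, whose endpoints have disjoint neighborhoods, yields G). Then there is a matrix A' ∈ S(H) with the Strong Multiplicity Property whose ordered multiplicity list is obtained from the ordered multiplicity list of A by appending a 1 at the end. -/

import Mathlib

open Matrix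

/-- The geometric multiplicity of `lam` as an eigenvalue of `A`:
`dim ker (A - lam • I)`. -/
noncomputable def multOf {m : Type*} [Fintype m] [DecidableEq m]
    (A : Matrix m m ℝ) (lam : ℝ) : ℕ :=
  Module.finrank ℝ (LinearMap.ker (A - lam • (1 : Matrix m m ℝ)).mulVecLin)

/-- The Strong Spectral Property. -/
def HasSSP {m : Type*} [Fintype m] [DecidableEq m] (A : Matrix m m ℝ) : Prop :=
  ∀ X : Matrix m m ℝ, X.IsSymm → Matrix.hadamard A X = 0 →
    Matrix.hadamard (1 : Matrix m m ℝ) X = 0 → A * X - X * A = 0 → X = 0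

/-- `A ∈ S(G)`: `A` is symmetric and its off-diagonal nonzero pattern is given by `G`. -/
def InS {m : Type*} [Fintype m] [DecidableEq m]
    (G : SimpleGraph m) (A : Matrix m m ℝ) : Prop :=
  A.IsSymm ∧ ∀ i j, i ≠ j → (A i j ≠ 0 ↔ G.Adj i j)


/-- The Strong Multiplicity Property for an `m × m` real symmetric matrix. -/
def HasSMP {m : ℕ} (A : Matrix (Fin m) (Fin m) ℝ) : Prop :=
  ∀ X : Matrix (Fin m) (Fin m) ℝ, X.IsSymm → Matrix.hadamard A X = 0 →
    Matrix.hadamard (1 : Matrix (Fin m) (Fin m) ℝ) X = 0 → A * X - X * A = 0 →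
    (∀ i : ℕ, 2 ≤ i → i ≤ m - 1 → (A ^ i * X).trace = 0) → X = 0

/-- The graph `H` on `{0, …, n+1}` obtained from `G` (on `{0, …, n}`) by splitting
the vertex `n` (the last vertex of `G`) into two adjacent vertices `n` and `n+1`:
the edges of `G` not incident to `n` are kept, vertex `n` is joined to the
neighbors in `α`, the new vertex `n+1` is joined to the neighbors in `β`, and
`n` and `n+1` are joined; contracting the edge `{n, n+1}` of `H` gives back `G`. -/
def decontract {n : ℕ} (G : SimpleGraph (Fin (n + 1))) (α β : Set (Fin (n + 1))) :
    SimpleGraph (Fin (n + 2)) :=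
  SimpleGraph.fromRel fun u w =>
    (∃ i j : Fin (n + 1), u = i.castSucc ∧ w = j.castSucc ∧ G.Adj i j ∧
        i ≠ Fin.last n ∧ j ≠ Fin.last n) ∨
    (∃ j : Fin (n + 1), j ∈ α ∧ u = (Fin.last n).castSucc ∧ w = j.castSucc) ∨
    (∃ j : Fin (n + 1), j ∈ β ∧ u = Fin.last (n + 1) ∧ w = j.castSucc) ∨
    (u = (Fin.last n).castSucc ∧ w = Fin.last (n + 1))

open scoped Topology

section Multiplicity

variable {m ι : Type*} [Fintype m] [DecidableEq m] [Fintype ι] [DecidableEq ι]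

/-- The multiplicity of `t` is the number of times it occurs in a diagonal form. -/
theorem multOf_eq_card {A : Matrix m m ℝ} {Q : Matrix m ι ℝ} {Q' : Matrix ι m ℝ} {d : ι → ℝ}
    (h₁ : Q' * Q = 1) (h₂ : Q * Q' = 1) (hA : A * Q = Q * diagonal d) (t : ℝ) :
    multOf A t = Fintype.card {i // d i = t} := by
  have hcard : Fintype.card m = Fintype.card ι := by
    have h := trace_mul_comm Q Q'
    rw [h₁, h₂, trace_one, trace_one] at h
    exact_mod_cast h
  have hd : diagonal (fun i => d i - t) = Q' * (A - t • 1) * Q := by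
    rw [Matrix.mul_sub, Matrix.sub_mul, Matrix.mul_assoc, hA, ← Matrix.mul_assoc, h₁,
      Matrix.mul_smul, Matrix.smul_mul, Matrix.mul_one, h₁, Matrix.one_mul]
    ext i j
    by_cases hij : i = j <;> simp [hij]
  have hA' : A - t • 1 = Q * diagonal (fun i => d i - t) * Q' := by
    rw [hd]
    simp only [Matrix.mul_assoc]
    rw [h₂, Matrix.mul_one, ← Matrix.mul_assoc, h₂, Matrix.one_mul]
  have hrank : (A - t • (1 : Matrix m m ℝ)).rank = (diagonal fun i => d i - t).rank := by
    apply le_antisymm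
    · rw [hA']
      exact (rank_mul_le_left _ _).trans (rank_mul_le_right _ _)
    · rw [hd]
      exact (rank_mul_le_left _ _).trans (rank_mul_le_right _ _)
  have hker := LinearMap.finrank_range_add_finrank_ker (A - t • (1 : Matrix m m ℝ)).mulVecLin
  rw [Module.finrank_fintype_fun_eq_card] at hker
  change (A - t • (1 : Matrix m m ℝ)).rank + multOf A t = _ at hker
  rw [hrank, rank_diagonal, Fintype.card_subtype_compl, hcard] at hker
  have hle : Fintype.card {i // d i - t = 0} ≤ Fintype.card ι := Fintype.card_subtype_le _
  have heq : Fintype.card {i // d i = t} = Fintype.card {i // d i - t = 0} :=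
    Fintype.card_congr (Equiv.subtypeEquivRight fun i => sub_eq_zero.symm)
  omega

theorem Matrix.IsSymm.exists_orthogonal_diagonalization {A : Matrix m m ℝ} (hA : A.IsSymm) :
    ∃ (U : Matrix m m ℝ) (d : m → ℝ), Uᵀ * U = 1 ∧ A * U = U * diagonal d := by
  have hH : A.IsHermitian := by
    rw [Matrix.IsHermitian, conjTranspose_eq_transpose_of_trivial]
    exact hA
  have hU : (hH.eigenvectorUnitary : Matrix m m ℝ)ᵀ * hH.eigenvectorUnitary = 1 := by
    have h := Unitary.coe_star_mul_self hH.eigenvectorUnitary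
    rwa [star_eq_conjTranspose, conjTranspose_eq_transpose_of_trivial] at h
  refine ⟨hH.eigenvectorUnitary, hH.eigenvalues, hU, ?_⟩
  refine (congrArg (· * (hH.eigenvectorUnitary : Matrix m m ℝ)) hH.spectral_theorem).trans ?_
  rw [Unitary.conjStarAlgAut_apply, star_eq_conjTranspose, conjTranspose_eq_transpose_of_trivial,
    Matrix.mul_assoc, hU, Matrix.mul_one]
  rfl

end Multiplicity

section Tangent

/-- The pattern mask: entries on the diagonal or in the support of `A` are kept. -/
noncomputable def mask {m : Type*} (A : Matrix m m ℝ) : Matrix m m ℝ :=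
  open Classical in of fun i j => if i = j ∨ A i j ≠ 0 then 1 else 0

variable {m : ℕ}

/-- The first order deformations of a decomposition `B - p(A)` of a pattern matrix, up to
antisymmetric matrices. -/
noncomputable def deformationMap (A : Matrix (Fin m) (Fin m) ℝ) :
    (Matrix (Fin m) (Fin m) ℝ × Matrix (Fin m) (Fin m) ℝ × (Fin m → ℝ) ×
      Matrix (Fin m) (Fin m) ℝ) →ₗ[ℝ] Matrix (Fin m) (Fin m) ℝ where
  toFun v := hadamard (mask A) (v.1 + v.1ᵀ) + (A * (v.2.1 - v.2.1ᵀ) - (v.2.1 - v.2.1ᵀ) * A)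
    - ∑ k, v.2.2.1 k • A ^ (k : ℕ) + (v.2.2.2 - v.2.2.2ᵀ)
  map_add' v w := by
    simp only [Prod.fst_add, Prod.snd_add, transpose_add, Pi.add_apply, add_smul,
      Finset.sum_add_distrib, hadamard_add, Matrix.mul_add, Matrix.add_mul, Matrix.mul_sub,
      Matrix.sub_mul]
    abel
  map_smul' r v := by
    simp only [Prod.smul_fst, Prod.smul_snd, transpose_smul, Pi.smul_apply, smul_assoc,
      ← Finset.smul_sum, hadamard_smul, Matrix.mul_smul, Matrix.smul_mul, RingHom.id_apply,
      ← smul_add, ← smul_sub]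

theorem hadamard_eq_zero_iff {m : Type*} {A X : Matrix m m ℝ} :
    hadamard A X = 0 ↔ ∀ i j, A i j ≠ 0 → X i j = 0 := by
  simp only [← Matrix.ext_iff, hadamard_apply, Matrix.zero_apply, mul_eq_zero, ne_eq,
    or_iff_not_imp_left]

theorem trace_mul_transpose_eq_zero {m : Type*} [Fintype m] {X : Matrix m m ℝ}
    (h : (X * Xᵀ).trace = 0) : X = 0 := by
  rw [← conjTranspose_eq_transpose_of_trivial] at h
  exact (trace_mul_conjTranspose_self_eq_zero_iff).1 h

theorem deformationMap_surjective {A : Matrix (Fin m) (Fin m) ℝ} (hA : A.IsSymm) (hsmp : HasSMP A) :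
    Function.Surjective (deformationMap A) := by
  rw [← LinearMap.range_eq_top]
  by_contra hne
  obtain ⟨φ, hφ0, hφ⟩ := Submodule.exists_le_ker_of_lt_top _ (lt_top_iff_ne_top.2 hne)
  set X : Matrix (Fin m) (Fin m) ℝ := of fun i j => φ (single j i 1) with hX
  have hφX : ∀ Y, φ Y = (X * Y).trace := by
    intro Y
    conv_lhs => rw [matrix_eq_sum_single Y]
    simp only [map_sum, trace, diag, Matrix.mul_apply, hX, of_apply]
    rw [Finset.sum_comm]
    refine Finset.sum_congr rfl fun i _ => Finset.sum_congr rfl fun j _ => ?_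
    have : single j i (Y j i) = Y j i • (single j i 1 : Matrix (Fin m) (Fin m) ℝ) := by
      simp
    rw [this, map_smul, smul_eq_mul, mul_comm]
  have hzero : ∀ v, (X * deformationMap A v).trace = 0 := fun v => by
    rw [← hφX]; exact hφ ⟨v, rfl⟩
  have hsymm : Xᵀ = X := by
    have h : X - Xᵀ = 0 := by
      apply trace_mul_transpose_eq_zero
      have h := hzero (0, 0, 0, Xᵀ)
      simp only [deformationMap, LinearMap.coe_mk, AddHom.coe_mk, transpose_zero, add_zero,
        hadamard_zero, sub_zero, Matrix.mul_zero, Matrix.zero_mul, Pi.zero_apply, zero_smul,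
        Finset.sum_const_zero, zero_add, transpose_transpose, Matrix.mul_sub, trace_sub] at h
      have h2 : (Xᵀ * Xᵀ).trace = (X * X).trace := by
        rw [← transpose_mul, trace_transpose]
      simp only [transpose_sub, transpose_transpose, Matrix.sub_mul, Matrix.mul_sub, trace_sub, h2,
        trace_mul_comm Xᵀ X]
      linarith
    exact (sub_eq_zero.1 h).symm
  have hsymm' : ∀ i j, X i j = X j i := fun i j => congrFun (congrFun hsymm j) i
  have hmask : ∀ i j, i = j ∨ A i j ≠ 0 → X i j = 0 := by
    intro i j hij
    have h := hzero (single i j 1, 0, 0, 0)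
    simp only [deformationMap, LinearMap.coe_mk, AddHom.coe_mk, transpose_zero, add_zero,
      sub_zero, Matrix.mul_zero, Matrix.zero_mul, Pi.zero_apply, zero_smul, transpose_single,
      Finset.sum_const_zero] at h
    have hm : hadamard (mask A) (single i j 1 + single j i 1) = single i j 1 + single j i 1 := by
      have hji : j = i ∨ A j i ≠ 0 := by
        rwa [eq_comm, hA.apply i j]
      ext a b
      rw [hadamard_apply]
      by_cases hab : a = b ∨ A a b ≠ 0
      · simp [mask, hab]
      · have h1 : ¬ (i = a ∧ j = b) := by rintro ⟨rfl, rfl⟩; exact hab hij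
        have h2 : ¬ (j = a ∧ i = b) := by rintro ⟨rfl, rfl⟩; exact hab hji
        simp [h1, h2]
    rw [hm, Matrix.mul_add, trace_add, trace_mul_single, trace_mul_single] at h
    simp only [MulOpposite.op_one, one_smul] at h
    have := hsymm' i j
    linarith
  have hcomm : A * X - X * A = 0 := by
    apply trace_mul_transpose_eq_zero
    have h := hzero (0, X * A, 0, 0)
    simp only [deformationMap, LinearMap.coe_mk, AddHom.coe_mk, transpose_zero, add_zero,
      sub_zero, Pi.zero_apply, zero_smul, transpose_mul, hsymm, hA.eq, hadamard_zero,
      Finset.sum_const_zero, zero_add, Matrix.mul_sub, Matrix.sub_mul, trace_sub] at h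
    simp only [transpose_sub, transpose_mul, hsymm, hA.eq, Matrix.mul_sub, Matrix.sub_mul,
      trace_sub]
    have e1 : (X * (A * (X * A))).trace = (A * X * (A * X)).trace := by
      rw [trace_mul_comm, Matrix.mul_assoc, Matrix.mul_assoc, Matrix.mul_assoc]
    have e2 : (X * (A * (A * X))).trace = (A * X * (X * A)).trace := by
      rw [← Matrix.mul_assoc, trace_mul_comm, Matrix.mul_assoc]
    have e3 : (X * (X * A * A)).trace = (A * X * (X * A)).trace := by
      rw [← Matrix.mul_assoc, trace_mul_comm, Matrix.mul_assoc]
    have e4 : (X * (A * X * A)).trace = (X * A * (X * A)).trace := by simp only [Matrix.mul_assoc]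
    have e5 : (A * X * (A * X)).trace = (X * A * (X * A)).trace := by
      rw [Matrix.mul_assoc, trace_mul_comm]; simp only [Matrix.mul_assoc]
    have e6 : (X * A * (A * X)).trace = (A * X * (X * A)).trace := trace_mul_comm _ _
    linarith
  have htrace : ∀ i : ℕ, 2 ≤ i → i ≤ m - 1 → (A ^ i * X).trace = 0 := by
    intro i hi him
    have h := hzero (0, 0, Pi.single (⟨i, by omega⟩ : Fin m) 1, 0)
    simp only [deformationMap, LinearMap.coe_mk, AddHom.coe_mk, transpose_zero, add_zero,
      sub_zero, hadamard_zero, zero_sub, Matrix.mul_zero, Matrix.zero_mul] at h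
    rw [Finset.sum_eq_single (⟨i, by omega⟩ : Fin m)
      (fun b _ hb => by simp [Pi.single_eq_of_ne hb]) (by simp)] at h
    rw [trace_mul_comm]
    simpa using h
  have hX0 : X = 0 := hsmp X hsymm (hadamard_eq_zero_iff.2 fun i j h => hmask i j (Or.inr h))
    (hadamard_eq_zero_iff.2 fun i j h => hmask i j (Or.inl (by
      by_contra hij; exact h (one_apply_ne hij)))) hcomm htrace
  apply hφ0
  ext Y
  simp [hφX, hX0]

end Tangent

section Splitting

variable {I κ : Type*} [Fintype I] [DecidableEq I] [Fintype κ] [DecidableEq κ]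

/-- The bordered matrix with blocks `B`, `c`, `ε⁻¹` with respect to the orthogonal decomposition
of `ℝ^κ` into the range of the isometry `J` and the line through `w`. -/
noncomputable def bordered (J : Matrix κ I ℝ) (w : κ → ℝ) (B : Matrix I I ℝ) (c : I → ℝ)
    (ε : ℝ) : Matrix κ κ ℝ :=
  J * B * Jᵀ + vecMulVec (J *ᵥ c) w + vecMulVec w (J *ᵥ c) + ε⁻¹ • vecMulVec w w

/-- `J, w` is an orthonormal splitting of `ℝ^κ`. -/
structure IsSplitting (J : Matrix κ I ℝ) (w : κ → ℝ) : Prop where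
  transpose_mul_self : Jᵀ * J = 1
  transpose_mulVec : Jᵀ *ᵥ w = 0
  dotProduct_self : w ⬝ᵥ w = 1
  mul_transpose_add : J * Jᵀ + vecMulVec w w = 1

/-- The equations expressing that the image of `(J + ε w yᵀ) R` is an invariant subspace of
the bordered matrix, on which it acts as `D` in an orthonormal basis. -/
structure IsReduction (B : Matrix I I ℝ) (c y : I → ℝ) (R D : Matrix I I ℝ) (ε : ℝ) : Prop where
  isSymm : B.IsSymm
  invariant : y = ε • (B *ᵥ y) + (ε ^ 2 * (c ⬝ᵥ y)) • y - c
  orthonormal : Rᵀ * (1 + ε ^ 2 • vecMulVec y y) * R = 1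
  compression : Rᵀ * (B + ε • (vecMulVec c y + vecMulVec y c + vecMulVec y y)) * R = D

/-- The basis of the invariant subspace. -/
noncomputable def invBasis (J : Matrix κ I ℝ) (w : κ → ℝ) (y : I → ℝ) (R : Matrix I I ℝ)
    (ε : ℝ) : Matrix κ I ℝ :=
  (J + ε • vecMulVec w y) * R

/-- The normal vector of the invariant subspace. -/
noncomputable def invNormal (J : Matrix κ I ℝ) (w : κ → ℝ) (y : I → ℝ) (ε : ℝ) : κ → ℝ :=
  w - ε • (J *ᵥ y)

variable {J : Matrix κ I ℝ} {w : κ → ℝ} {B R D : Matrix I I ℝ} {c y : I → ℝ} {ε : ℝ}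

omit [DecidableEq I] [Fintype κ] [DecidableEq κ] in
theorem bordered_isSymm (hB : B.IsSymm) : (bordered J w B c ε).IsSymm := by
  simp only [bordered, Matrix.IsSymm, transpose_add, transpose_mul, transpose_transpose, hB.eq,
    transpose_vecMulVec, transpose_smul, Matrix.mul_assoc]
  abel

namespace IsSplitting

theorem vecMulVec_mul_eq_zero (h : IsSplitting J w) {l : Type*} (x : l → ℝ) :
    vecMulVec x w * J = 0 := by
  rw [vecMulVec_mul, ← mulVec_transpose, h.transpose_mulVec]
  ext i j
  simp [vecMulVec_apply]

theorem transpose_mul_vecMulVec (h : IsSplitting J w) {l : Type*} (x : l → ℝ) :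
    Jᵀ * vecMulVec w x = 0 := by
  rw [mul_vecMulVec, h.transpose_mulVec]
  exact zero_vecMulVec x

theorem mulVec_dotProduct (h : IsSplitting J w) (x : I → ℝ) : (J *ᵥ x) ⬝ᵥ w = 0 := by
  rw [dotProduct_comm, dotProduct_mulVec, ← mulVec_transpose, h.transpose_mulVec, zero_dotProduct]

theorem transpose_mulVec_mulVec (h : IsSplitting J w) (x : I → ℝ) : Jᵀ *ᵥ (J *ᵥ x) = x := by
  rw [mulVec_mulVec, h.transpose_mul_self, one_mulVec]

theorem bordered_mul (h : IsSplitting J w) :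
    bordered J w B c ε * J = J * B + vecMulVec w c := by
  have h2 : (J *ᵥ c) ᵥ* J = c := by rw [← mulVec_transpose, h.transpose_mulVec_mulVec]
  rw [bordered, Matrix.add_mul, Matrix.add_mul, Matrix.add_mul, Matrix.smul_mul,
    h.vecMulVec_mul_eq_zero, h.vecMulVec_mul_eq_zero, vecMulVec_mul, h2, Matrix.mul_assoc,
    h.transpose_mul_self, Matrix.mul_one, smul_zero, add_zero, add_zero]

theorem bordered_mulVec (h : IsSplitting J w) :
    bordered J w B c ε *ᵥ w = J *ᵥ c + ε⁻¹ • w := by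
  simp only [bordered, Matrix.add_mulVec, ← mulVec_mulVec, h.transpose_mulVec, mulVec_zero,
    vecMulVec_mulVec, smul_mulVec, h.dotProduct_self, h.mulVec_dotProduct, MulOpposite.op_one,
    MulOpposite.op_zero, one_smul, zero_smul, zero_add, add_zero]

theorem invBasis_orthonormal (h : IsSplitting J w) (hr : IsReduction B c y R D ε) :
    (invBasis J w y R ε)ᵀ * invBasis J w y R ε = 1 := by
  rw [← hr.orthonormal]
  simp only [invBasis, transpose_mul, transpose_add, transpose_smul, transpose_vecMulVec,
    Matrix.mul_assoc]
  congr 1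
  rw [← Matrix.mul_assoc]
  congr 1
  rw [Matrix.mul_add, Matrix.add_mul, h.transpose_mul_self, Matrix.smul_mul, Matrix.mul_smul,
    Matrix.add_mul, h.vecMulVec_mul_eq_zero, h.transpose_mul_vecMulVec, Matrix.smul_mul,
    vecMulVec_mul_vecMulVec, h.dotProduct_self, one_smul, smul_zero, add_zero, zero_add, smul_smul,
    sq]

theorem bordered_mul_invBasis (h : IsSplitting J w) (hr : IsReduction B c y R D ε) (hε : ε ≠ 0) :
    bordered J w B c ε * invBasis J w y R ε = invBasis J w y R ε * D := by
  set S : Matrix I I ℝ := 1 + ε ^ 2 • vecMulVec y y with hS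
  set M : Matrix I I ℝ := B + ε • vecMulVec c y with hM
  have hyB : y ᵥ* B = B *ᵥ y := by rw [← mulVec_transpose, hr.isSymm.eq]
  have hinv : ∀ i, y i = ε * (B *ᵥ y) i + ε ^ 2 * (c ⬝ᵥ y) * y i - c i := fun i =>
    congrFun hr.invariant i
  have hV : bordered J w B c ε * (J + ε • vecMulVec w y) = (J + ε • vecMulVec w y) * M := by
    rw [Matrix.mul_add, h.bordered_mul, Matrix.mul_smul, mul_vecMulVec, h.bordered_mulVec]
    simp only [hM, Matrix.add_mul, Matrix.mul_add, Matrix.smul_mul, Matrix.mul_smul, mul_vecMulVec,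
      vecMulVec_mul, add_mulVec, smul_mulVec, vecMulVec_mulVec, hyB]
    ext i j
    simp only [Matrix.add_apply, Matrix.smul_apply, vecMulVec_apply, smul_eq_mul,
      Pi.add_apply, Pi.smul_apply, MulOpposite.smul_eq_mul_unop, MulOpposite.unop_op,
      dotProduct_comm y c]
    have := hinv j
    field_simp
    linear_combination w i * this
  have hSM : S * M = B + ε • (vecMulVec c y + vecMulVec y c + vecMulVec y y) := by
    simp only [hM, hS, Matrix.add_mul, Matrix.mul_add, Matrix.smul_mul, Matrix.mul_smul,
      mul_vecMulVec, vecMulVec_mul, add_mulVec, smul_mulVec, one_mulVec, vecMulVec_mulVec, hyB,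
      Matrix.one_mul]
    ext i j
    simp only [Matrix.add_apply, Matrix.smul_apply, vecMulVec_apply, smul_eq_mul, Pi.smul_apply,
      MulOpposite.smul_eq_mul_unop, MulOpposite.unop_op, dotProduct_comm y c, Pi.add_apply]
    linear_combination (-ε * y i) * hinv j
  have hRS : R * (Rᵀ * S) = 1 := mul_eq_one_comm.1 hr.orthonormal
  rw [invBasis, ← Matrix.mul_assoc, hV, Matrix.mul_assoc, Matrix.mul_assoc]
  congr 1
  rw [← hr.compression, ← hSM]
  calc M * R = R * (Rᵀ * S) * M * R := by rw [hRS, Matrix.one_mul]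
    _ = _ := by simp only [Matrix.mul_assoc]

theorem bordered_mulVec_invNormal (h : IsSplitting J w) (hr : IsReduction B c y R D ε)
    (hε : ε ≠ 0) :
    bordered J w B c ε *ᵥ invNormal J w y ε = (ε⁻¹ - ε * (c ⬝ᵥ y)) • invNormal J w y ε := by
  have hc : c = ε • (B *ᵥ y) + (ε ^ 2 * (c ⬝ᵥ y)) • y - y := by
    conv_lhs => rw [← sub_sub_cancel (ε • (B *ᵥ y) + (ε ^ 2 * (c ⬝ᵥ y)) • y) c, ← hr.invariant]
  have hJc : J *ᵥ c = ε • (J *ᵥ (B *ᵥ y)) + (ε ^ 2 * (c ⬝ᵥ y)) • (J *ᵥ y) - J *ᵥ y := by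
    conv_lhs => rw [hc]
    simp only [mulVec_add, mulVec_sub, mulVec_smul]
  rw [invNormal, mulVec_sub, mulVec_smul, mulVec_mulVec, h.bordered_mul, h.bordered_mulVec,
    add_mulVec, vecMulVec_mulVec, ← mulVec_mulVec, hJc]
  ext i
  simp only [Pi.sub_apply, Pi.add_apply, Pi.smul_apply, smul_eq_mul,
      MulOpposite.smul_eq_mul_unop, MulOpposite.unop_op]
  field_simp
  ring

theorem transpose_invBasis_mulVec (h : IsSplitting J w) :
    (invBasis J w y R ε)ᵀ *ᵥ invNormal J w y ε = 0 := by
  have h1 : (vecMulVec y w) *ᵥ (J *ᵥ y) = 0 := by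
    rw [mulVec_mulVec, h.vecMulVec_mul_eq_zero, zero_mulVec]
  simp only [invBasis, invNormal, transpose_mul, ← mulVec_mulVec, transpose_add, transpose_smul,
    transpose_vecMulVec, add_mulVec, mulVec_sub, h.transpose_mulVec, smul_mulVec, mulVec_smul,
    vecMulVec_mulVec y w w, h.dotProduct_self, h1, h.transpose_mulVec_mulVec]
  simp [mulVec_smul]

theorem invNormal_dotProduct_self_pos (h : IsSplitting J w) :
    0 < invNormal J w y ε ⬝ᵥ invNormal J w y ε := by
  have h0 : invNormal J w y ε ≠ 0 := fun h0 => by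
    have h1 : invNormal J w y ε ⬝ᵥ w = 1 := by
      rw [invNormal, sub_dotProduct, smul_dotProduct, h.mulVec_dotProduct, h.dotProduct_self,
        smul_zero, sub_zero]
    rw [h0, zero_dotProduct] at h1
    exact zero_ne_one h1
  have h1 : ∀ v : κ → ℝ, 0 ≤ v ⬝ᵥ v := fun v => Finset.sum_nonneg fun i _ => mul_self_nonneg _
  exact (h1 _).lt_of_ne' (mt dotProduct_self_eq_zero.1 h0)

theorem card_eq (h : IsSplitting J w) : Fintype.card (I ⊕ Unit) = Fintype.card κ := by
  have h1 := congrArg trace h.mul_transpose_add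
  rw [trace_add, trace_mul_comm, h.transpose_mul_self, trace_vecMulVec, h.dotProduct_self,
    trace_one, trace_one] at h1
  rw [Fintype.card_sum, Fintype.card_unit]
  exact_mod_cast h1

theorem frame_mul_frame (h : IsSplitting J w) (hr : IsReduction B c y R D ε) {U : Matrix I I ℝ}
    (hU : Uᵀ * U = 1) :
    fromRows (invBasis J w y R ε * U)ᵀ
        (replicateRow Unit ((invNormal J w y ε ⬝ᵥ invNormal J w y ε)⁻¹ • invNormal J w y ε)) *
      fromCols (invBasis J w y R ε * U) (replicateCol Unit (invNormal J w y ε)) = 1 := by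
  set W := invBasis J w y R ε
  set v := invNormal J w y ε
  have hW : Wᵀ * W = 1 := h.invBasis_orthonormal hr
  have hWv : Wᵀ *ᵥ v = 0 := h.transpose_invBasis_mulVec
  have hv : v ⬝ᵥ v ≠ 0 := h.invNormal_dotProduct_self_pos.ne'
  rw [fromRows_mul_fromCols, ← fromBlocks_one]
  congr 1
  · rw [transpose_mul, Matrix.mul_assoc, ← Matrix.mul_assoc Wᵀ, hW, Matrix.one_mul, hU]
  · rw [← replicateCol_mulVec, transpose_mul, ← mulVec_mulVec, hWv, mulVec_zero]
    rfl
  · rw [← replicateRow_vecMul, ← mulVec_transpose, transpose_mul, mulVec_smul, ← mulVec_mulVec,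
      hWv, mulVec_zero, smul_zero]
    rfl
  · ext i j
    rw [replicateRow_mul_replicateCol_apply, smul_dotProduct, smul_eq_mul, inv_mul_cancel₀ hv,
      one_apply_eq]

theorem invBasis_mul_transpose (h : IsSplitting J w) (hr : IsReduction B c y R D ε) :
    invBasis J w y R ε * (invBasis J w y R ε)ᵀ +
      (invNormal J w y ε ⬝ᵥ invNormal J w y ε)⁻¹ •
        vecMulVec (invNormal J w y ε) (invNormal J w y ε) = 1 := by
  have hQ := (mul_eq_one_comm_of_card_eq _ _ _ h.card_eq).1
    (h.frame_mul_frame hr (U := 1) (by simp))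
  rw [fromCols_mul_fromRows, Matrix.mul_one, ← vecMulVec_eq, vecMulVec_smul] at hQ
  exact hQ

/-- An orthonormal eigenbasis for `D` gives one for the bordered matrix. -/
theorem exists_diagonalization (h : IsSplitting J w) (hr : IsReduction B c y R D ε)
    (hε : ε ≠ 0) {U : Matrix I I ℝ} {d : I → ℝ} (hU : Uᵀ * U = 1) (hD : D * U = U * diagonal d) :
    ∃ (Q : Matrix κ (I ⊕ Unit) ℝ) (Q' : Matrix (I ⊕ Unit) κ ℝ), Q' * Q = 1 ∧ Q * Q' = 1 ∧
      bordered J w B c ε * Q =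
        Q * diagonal (Sum.elim d fun _ : Unit => ε⁻¹ - ε * (c ⬝ᵥ y)) := by
  set W := invBasis J w y R ε
  set v := invNormal J w y ε
  have hQ := h.frame_mul_frame hr hU
  refine ⟨_, _, hQ, (mul_eq_one_comm_of_card_eq _ _ _ h.card_eq).1 hQ, ?_⟩
  rw [← fromBlocks_diagonal, mul_fromCols, fromCols_mul_fromBlocks, ← Matrix.mul_assoc,
    h.bordered_mul_invBasis hr hε, ← replicateCol_mulVec, h.bordered_mulVec_invNormal hr hε,
    Matrix.mul_zero, Matrix.mul_zero, add_zero, zero_add, Matrix.mul_assoc, hD, Matrix.mul_assoc]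
  congr 1
  ext i j
  simp [Matrix.mul_apply, replicateCol_apply, mul_comm]

theorem bordered_pow_mul_deflation (h : IsSplitting J w) (hr : IsReduction B c y R D ε) (hε : ε ≠ 0)
    (k : ℕ) :
    bordered J w B c ε ^ k * ((1 - ε ^ 2 * (c ⬝ᵥ y)) • 1 - ε • bordered J w B c ε) =
      invBasis J w y R ε * (D ^ k * ((1 - ε ^ 2 * (c ⬝ᵥ y)) • 1 - ε • D)) *
        (invBasis J w y R ε)ᵀ := by
  set A' := bordered J w B c ε
  set W := invBasis J w y R ε
  set v := invNormal J w y ε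
  set l := 1 - ε ^ 2 * (c ⬝ᵥ y) with hl
  have hAW : A' * W = W * D := h.bordered_mul_invBasis hr hε
  have hAv : (l • 1 - ε • A') *ᵥ v = 0 := by
    rw [sub_mulVec, smul_mulVec, smul_mulVec, h.bordered_mulVec_invNormal hr hε, one_mulVec,
      smul_smul, ← sub_smul, hl, mul_sub, mul_inv_cancel₀ hε, ← mul_assoc, ← sq, sub_self,
      zero_smul]
  have hpow : A' ^ k * W = W * D ^ k := by
    induction k with
    | zero => simp
    | succ k ih => rw [pow_succ, Matrix.mul_assoc, hAW, ← Matrix.mul_assoc, ih, Matrix.mul_assoc,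
        pow_succ]
  have hlW : (l • 1 - ε • A') * W = W * (l • 1 - ε • D) := by
    rw [Matrix.sub_mul, Matrix.smul_mul, Matrix.smul_mul, hAW, Matrix.mul_sub, Matrix.mul_smul,
      Matrix.mul_smul, Matrix.one_mul, Matrix.mul_one]
  calc A' ^ k * (l • 1 - ε • A') = A' ^ k * (l • 1 - ε • A') *
        (W * Wᵀ + (v ⬝ᵥ v)⁻¹ • vecMulVec v v) := by
        rw [h.invBasis_mul_transpose hr, Matrix.mul_one]
    _ = A' ^ k * ((l • 1 - ε • A') * W) * Wᵀ := by
        rw [Matrix.mul_add, Matrix.mul_smul, Matrix.mul_assoc, Matrix.mul_assoc, mul_vecMulVec,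
          hAv, zero_vecMulVec, Matrix.mul_zero, smul_zero, add_zero]
        simp only [Matrix.mul_assoc]
    _ = W * (D ^ k * (l • 1 - ε • D)) * Wᵀ := by
        rw [hlW, ← Matrix.mul_assoc, hpow, Matrix.mul_assoc W]

end IsSplitting

end Splitting

section Perturbation

variable {m : ℕ}

/-- The matrices obtained from `A` by adding a polynomial in `A`. -/
noncomputable def polyPerturb (A : Matrix (Fin m) (Fin m) ℝ) (p : Fin m → ℝ) :
    Matrix (Fin m) (Fin m) ℝ :=
  A + ∑ k, p k • A ^ (k : ℕ)

/-- The `ℓ`-th column of `B`, with entries rescaled by `σ`. -/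
def signedCol (σ : Fin m → ℝ) (ℓ : Fin m) (B : Matrix (Fin m) (Fin m) ℝ) : Fin m → ℝ :=
  fun i => σ i * B i ℓ

/-- The space of parameters `(X, y, R, p, Y, Z, ε)`. -/
abbrev Params (m : ℕ) : Type :=
  (Fin m → Fin m → ℝ) × (Fin m → ℝ) × (Fin m → Fin m → ℝ) × (Fin m → ℝ) × (Fin m → Fin m → ℝ) ×
    (Fin m → Fin m → ℝ) × ℝ

/-- The space of defects in the equations of a reduction. -/
abbrev Defects (m : ℕ) : Type :=
  (Fin m → ℝ) × (Fin m → Fin m → ℝ) × (Fin m → Fin m → ℝ) × ℝ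

/-- The symmetric matrix with the pattern of `A` determined by `X`. -/
noncomputable def patternPart (A : Matrix (Fin m) (Fin m) ℝ) (X : Fin m → Fin m → ℝ) :
    Matrix (Fin m) (Fin m) ℝ :=
  hadamard (mask A) (of X + (of X)ᵀ)

/-- The equations of a reduction, with antisymmetric slack variables `Y - Yᵀ` and `Z - Zᵀ`. -/
noncomputable def defect (A : Matrix (Fin m) (Fin m) ℝ) (σ : Fin m → ℝ) (ℓ : Fin m) :
    Params m → Defects m := fun ⟨X, y, R, p, Y, Z, ε⟩ =>
  let B := patternPart A X
  let c := signedCol σ ℓ B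
  (y - (ε • (B *ᵥ y) + (ε ^ 2 * (c ⬝ᵥ y)) • y - c),
    of.symm ((of R)ᵀ * (1 + ε ^ 2 • vecMulVec y y) * of R - 1 + (of Y - (of Y)ᵀ)),
    of.symm ((of R)ᵀ * (B + ε • (vecMulVec c y + vecMulVec y c + vecMulVec y y)) * of R
      - polyPerturb A p + (of Z - (of Z)ᵀ)),
    ε)

theorem contDiff_defect (A : Matrix (Fin m) (Fin m) ℝ) (σ : Fin m → ℝ) (ℓ : Fin m) :
    ContDiff ℝ 1 (defect A σ ℓ) := by
  unfold defect
  refine ContDiff.prodMk ?_ (ContDiff.prodMk ?_ (ContDiff.prodMk ?_ ?_))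
  · refine contDiff_pi.2 fun i => ?_
    simp only [Pi.sub_apply, Pi.add_apply, Pi.smul_apply, smul_eq_mul, mulVec, dotProduct,
      signedCol, patternPart, hadamard_apply, Matrix.add_apply, of_apply, transpose_apply]
    fun_prop
  · refine contDiff_pi.2 fun i => contDiff_pi.2 fun j => ?_
    simp only [of_symm_apply, Matrix.sub_apply, Matrix.add_apply, Matrix.smul_apply, smul_eq_mul,
      Matrix.mul_apply, vecMulVec_apply, of_apply, transpose_apply]
    fun_prop
  · refine contDiff_pi.2 fun i => contDiff_pi.2 fun j => ?_
    simp only [of_symm_apply, Matrix.sub_apply, Matrix.add_apply, Matrix.smul_apply, smul_eq_mul,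
      Matrix.mul_apply, vecMulVec_apply, of_apply, transpose_apply, polyPerturb, Matrix.sum_apply,
      signedCol, patternPart, hadamard_apply]
    fun_prop
  · fun_prop

/-- The parameters of the unperturbed solution. -/
noncomputable def baseParams (A : Matrix (Fin m) (Fin m) ℝ) (σ : Fin m → ℝ) (ℓ : Fin m) :
    Params m :=
  (of.symm ((2⁻¹ : ℝ) • A), -signedCol σ ℓ A, of.symm 1, 0, 0, 0, 0)

theorem patternPart_apply_of_eq_zero {A : Matrix (Fin m) (Fin m) ℝ} (X : Fin m → Fin m → ℝ)
    {i j : Fin m} (hij : i ≠ j) (h : A i j = 0) : patternPart A X i j = 0 := by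
  simp [patternPart, mask, hij, h]

theorem patternPart_isSymm {A : Matrix (Fin m) (Fin m) ℝ} (hA : A.IsSymm)
    (X : Fin m → Fin m → ℝ) : (patternPart A X).IsSymm := by
  ext i j
  simp only [patternPart, mask, transpose_apply, hadamard_apply, Matrix.add_apply, of_apply,
    eq_comm (a := j), hA.apply i j, add_comm]
  congr

theorem patternPart_half {A : Matrix (Fin m) (Fin m) ℝ} (hA : A.IsSymm) :
    patternPart A (of.symm ((2⁻¹ : ℝ) • A)) = A := by
  ext i j
  by_cases h : i = j ∨ A i j ≠ 0
  · simp only [patternPart, mask, hadamard_apply, Matrix.add_apply, of_apply, transpose_apply,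
      Matrix.smul_apply, hA.apply i j, h, if_true, Equiv.apply_symm_apply, smul_eq_mul]
    ring
  · have h0 : A i j = 0 := by tauto
    have hij : i ≠ j := by tauto
    simp [patternPart, mask, hij, h0]

theorem patternPart_add_smul (A : Matrix (Fin m) (Fin m) ℝ) (X X' : Fin m → Fin m → ℝ) (s : ℝ) :
    patternPart A (X + s • X') = patternPart A X + s • patternPart A X' := by
  ext i j
  simp only [patternPart, hadamard_apply, Matrix.add_apply, of_apply, transpose_apply,
    Matrix.smul_apply, Pi.add_apply, Pi.smul_apply, smul_eq_mul]
  ring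

theorem hasDerivAt_of_eq_cubic {E : Type*} [NormedAddCommGroup E] [NormedSpace ℝ E] {f : ℝ → E}
    {T S S' : E} (h : ∀ s, f s = s • T + s ^ 2 • S + s ^ 3 • S') : HasDerivAt f T 0 := by
  have h1 : HasDerivAt (fun s : ℝ => s • T + s ^ 2 • S + s ^ 3 • S')
      ((1 : ℝ) • T + ((2 : ℕ) * (0 : ℝ) ^ (2 - 1) * 1) • S +
        ((3 : ℕ) * (0 : ℝ) ^ (3 - 1) * 1) • S') 0 :=
    (((hasDerivAt_id (0 : ℝ)).smul_const T).add (((hasDerivAt_id (0 : ℝ)).pow 2).smul_const S)).add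
      (((hasDerivAt_id (0 : ℝ)).pow 3).smul_const S')
  rw [funext h]
  simpa using h1

theorem defect_baseParams {A : Matrix (Fin m) (Fin m) ℝ} (hA : A.IsSymm) (σ : Fin m → ℝ)
    (ℓ : Fin m) : defect A σ ℓ (baseParams A σ ℓ) = 0 := by
  simp only [defect, baseParams, patternPart_half hA, polyPerturb, Equiv.apply_symm_apply]
  refine Prod.ext ?_ (Prod.ext ?_ (Prod.ext ?_ rfl))
  · simp
  · ext i j
    simp
  · ext i j
    simp

theorem exists_fderiv_defect_eq {A : Matrix (Fin m) (Fin m) ℝ} (hA : A.IsSymm) (hsmp : HasSMP A)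
    (σ : Fin m → ℝ) (ℓ : Fin m) (T₁ : Fin m → ℝ) (T₂ T₃ : Fin m → Fin m → ℝ) :
    ∃ v, fderiv ℝ (defect A σ ℓ) (baseParams A σ ℓ) v = (T₁, T₂, T₃, 0) := by
  obtain ⟨⟨X, K, p, Z⟩, hX⟩ := deformationMap_surjective hA hsmp
    (of T₃ - (2⁻¹ : ℝ) • ((of T₂)ᵀ * A + A * of T₂))
  set P : Matrix (Fin m) (Fin m) ℝ := (2⁻¹ : ℝ) • of T₂ + (K - Kᵀ) with hP
  set B := patternPart A (of.symm X) with hB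
  set v : Params m := (of.symm X, T₁ - signedCol σ ℓ B, of.symm P, p, (2⁻¹ : ℝ) • T₂, of.symm Z, 0)
    with hv
  have hT₂ : P + Pᵀ + ((2⁻¹ : ℝ) • of T₂ - ((2⁻¹ : ℝ) • of T₂)ᵀ) = of T₂ := by
    rw [hP]
    simp only [transpose_add, transpose_sub, transpose_smul, transpose_transpose]
    module
  have hT₃ : Pᵀ * A + A * P + B - ∑ k, p k • A ^ (k : ℕ) + (Z - Zᵀ) = of T₃ := by
    have hX' : B + (A * (K - Kᵀ) - (K - Kᵀ) * A) - ∑ k, p k • A ^ (k : ℕ) + (Z - Zᵀ) =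
      of T₃ - (2⁻¹ : ℝ) • ((of T₂)ᵀ * A + A * of T₂) := hX
    rw [eq_sub_iff_add_eq] at hX'
    rw [← hX', hP]
    simp only [transpose_add, transpose_sub, transpose_smul, transpose_transpose, Matrix.add_mul,
      Matrix.mul_add, Matrix.smul_mul, Matrix.mul_smul, Matrix.sub_mul, Matrix.mul_sub]
    module
  have hexpand : ∀ s : ℝ, defect A σ ℓ (baseParams A σ ℓ + s • v) =
      s • ((T₁, T₂, T₃, 0) : Defects m) +
        s ^ 2 • ((0, of.symm (Pᵀ * P), of.symm (Pᵀ * B + B * P + Pᵀ * A * P), 0) : Defects m) +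
        s ^ 3 • ((0, 0, of.symm (Pᵀ * B * P), 0) : Defects m) := by
    intro s
    simp only [baseParams, hv, Prod.smul_mk, Prod.mk_add_mk, defect, patternPart_add_smul,
      patternPart_half hA, smul_zero, add_zero, zero_smul, ← hB, zero_add, sq, zero_mul]
    refine Prod.ext ?_ (Prod.ext ?_ (Prod.ext ?_ rfl))
    · ext i
      simp [signedCol]
      ring
    · apply of.injective
      change (1 + s • P)ᵀ * 1 * (1 + s • P) - 1 + (s • (2⁻¹ : ℝ) • of T₂ -
        (s • (2⁻¹ : ℝ) • of T₂)ᵀ) = s • of T₂ + (s * s) • (Pᵀ * P)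
      conv_rhs => rw [← hT₂]
      simp only [transpose_add, transpose_smul, transpose_one, Matrix.add_mul,
        Matrix.mul_add, Matrix.smul_mul, Matrix.mul_smul, Matrix.mul_one, Matrix.one_mul]
      module
    · apply of.injective
      change (1 + s • P)ᵀ * (A + s • B) * (1 + s • P) - polyPerturb A (s • p) + (s • Z -
        (s • Z)ᵀ) = s • of T₃ + (s * s) • (Pᵀ * B + B * P + Pᵀ * A * P) + s ^ 3 • (Pᵀ * B * P)
      have hp : polyPerturb A (s • p) = A + s • ∑ k, p k • A ^ (k : ℕ) := by
        simp only [polyPerturb, Pi.smul_apply, smul_assoc, ← Finset.smul_sum]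
      rw [hp, ← hT₃]
      simp only [transpose_add, transpose_smul, transpose_one, Matrix.add_mul,
        Matrix.mul_add, Matrix.smul_mul, Matrix.mul_smul, Matrix.mul_one, Matrix.one_mul]
      module
  refine ⟨v, ?_⟩
  have hd : HasFDerivAt (defect A σ ℓ) (fderiv ℝ (defect A σ ℓ) (baseParams A σ ℓ))
      (baseParams A σ ℓ + (0 : ℝ) • v) := by
    rw [zero_smul, add_zero]
    exact ((contDiff_defect A σ ℓ).differentiable one_ne_zero _).hasFDerivAt
  have hline : HasDerivAt (fun s : ℝ => baseParams A σ ℓ + s • v) v 0 := by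
    simpa using ((hasDerivAt_id (0 : ℝ)).smul_const v).const_add (baseParams A σ ℓ)
  exact (hd.comp_hasDerivAt (0 : ℝ) hline).unique
    (hasDerivAt_of_eq_cubic (f := defect A σ ℓ ∘ fun s => baseParams A σ ℓ + s • v) hexpand)

theorem range_fderiv_defect {A : Matrix (Fin m) (Fin m) ℝ} (hA : A.IsSymm) (hsmp : HasSMP A)
    (σ : Fin m → ℝ) (ℓ : Fin m) :
    (fderiv ℝ (defect A σ ℓ) (baseParams A σ ℓ) : Params m →ₗ[ℝ] Defects m).range = ⊤ := by
  rw [LinearMap.range_eq_top]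
  rintro ⟨T₁, T₂, T₃, e⟩
  set f' := fderiv ℝ (defect A σ ℓ) (baseParams A σ ℓ)
  have hd : HasFDerivAt (defect A σ ℓ) f' (baseParams A σ ℓ) :=
    ((contDiff_defect A σ ℓ).differentiable one_ne_zero _).hasFDerivAt
  have hlast : ∀ v : Params m, (f' v).2.2.2 = v.2.2.2.2.2.2 := by
    intro v
    have h1 : HasFDerivAt (fun v : Params m => (defect A σ ℓ v).2.2.2) _ (baseParams A σ ℓ) :=
      hd.snd.snd.snd
    have h2 := (hasFDerivAt_id (𝕜 := ℝ) (baseParams A σ ℓ)).snd.snd.snd.snd.snd.snd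
    exact DFunLike.congr_fun (h1.unique h2) v
  set u : Params m := (0, 0, 0, 0, 0, 0, e)
  obtain ⟨v, hv⟩ := exists_fderiv_defect_eq hA hsmp σ ℓ (T₁ - (f' u).1) (T₂ - (f' u).2.1)
    (T₃ - (f' u).2.2.1)
  refine ⟨v + u, ?_⟩
  change f' (v + u) = _
  rw [map_add, hv]
  have hu := hlast u
  refine Prod.ext ?_ (Prod.ext ?_ (Prod.ext ?_ ?_))
  · simp
  · simp
  · simp
  · simpa using hu

theorem Matrix.IsSymm.polyPerturb {A : Matrix (Fin m) (Fin m) ℝ} (hA : A.IsSymm)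
    (p : Fin m → ℝ) : (polyPerturb A p).IsSymm := by
  simp only [_root_.polyPerturb, Matrix.IsSymm, transpose_add, transpose_sum, transpose_smul,
    transpose_pow, hA.eq]

theorem eq_of_isSymm_of_sub_add_antisymm {S D N : Matrix (Fin m) (Fin m) ℝ} (hS : S.IsSymm)
    (hD : D.IsSymm) (h : S - D + (N - Nᵀ) = 0) : S = D := by
  have h2 := congrArg transpose h
  simp only [transpose_add, transpose_sub, transpose_transpose, hS.eq, hD.eq, transpose_zero] at h2
  have h3 : (2 : ℝ) • (S - D) = 0 := by
    have : (2 : ℝ) • (S - D) = (S - D + (N - Nᵀ)) + (S - D + (Nᵀ - N)) := by module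
    rw [this, h, h2, add_zero]
  exact sub_eq_zero.1 ((smul_eq_zero_iff_right two_ne_zero).1 h3)

/-- Any open condition satisfied by the unperturbed solution is satisfied by some reduction of a
matrix with the pattern of `A` to a polynomial perturbation of `A`, with positive `ε`. -/
theorem exists_isReduction {A : Matrix (Fin m) (Fin m) ℝ} (hA : A.IsSymm) (hsmp : HasSMP A)
    (σ : Fin m → ℝ) (ℓ : Fin m)
    {P : Matrix (Fin m) (Fin m) ℝ × (Fin m → ℝ) × Matrix (Fin m) (Fin m) ℝ × (Fin m → ℝ) × ℝ →
      Prop}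
    (hP : ∀ᶠ v in 𝓝 (A, -signedCol σ ℓ A, 1, 0, 0), P v) :
    ∃ B y R p ε, 0 < ε ∧ P (B, y, R, p, ε) ∧ (∀ i j, i ≠ j → A i j = 0 → B i j = 0) ∧
      IsReduction B (signedCol σ ℓ B) y R (polyPerturb A p) ε := by
  have hstrict := (contDiff_defect A σ ℓ).contDiffAt.hasStrictFDerivAt (x := baseParams A σ ℓ)
    one_ne_zero
  have hmap := hstrict.map_nhds_eq_of_surj (range_fderiv_defect hA hsmp σ ℓ)
  rw [defect_baseParams hA] at hmap
  have hcont : Continuous fun v : Params m =>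
      (patternPart A v.1, v.2.1, of v.2.2.1, v.2.2.2.1, v.2.2.2.2.2.2) := by
    have h1 : Continuous fun v : Params m => patternPart A v.1 := by
      refine continuous_matrix fun i j => ?_
      simp only [patternPart, hadamard_apply, Matrix.add_apply, of_apply, transpose_apply]
      fun_prop
    have h2 : Continuous fun v : Params m => (of v.2.2.1 : Matrix (Fin m) (Fin m) ℝ) := by
      refine continuous_matrix fun i j => ?_
      simp only [of_apply]
      fun_prop
    fun_prop
  have hev : ∀ᶠ v in 𝓝 (baseParams A σ ℓ),
      P (patternPart A v.1, v.2.1, of v.2.2.1, v.2.2.2.1, v.2.2.2.2.2.2) := by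
    refine hcont.continuousAt.eventually ?_
    simpa only [baseParams, patternPart_half hA, Equiv.apply_symm_apply] using hP
  have himage : ∀ᶠ d in 𝓝 0, d ∈ defect A σ ℓ '' {v | P (patternPart A v.1, v.2.1, of v.2.2.1,
      v.2.2.2.1, v.2.2.2.2.2.2)} := by
    rw [← hmap]
    exact Filter.image_mem_map hev
  have hε : Filter.Tendsto (fun ε : ℝ => ((0, 0, 0, ε) : Defects m)) (𝓝[>] 0) (𝓝 0) := by
    have : Continuous fun ε : ℝ => ((0, 0, 0, ε) : Defects m) := by fun_prop
    exact (this.tendsto 0).mono_left nhdsWithin_le_nhds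
  obtain ⟨ε, ⟨v, hPv, hv⟩, hpos⟩ := ((hε.eventually himage).and self_mem_nhdsWithin).exists
  obtain ⟨X, y, R, p, Y, Z, ε'⟩ := v
  simp only [defect, Prod.mk.injEq] at hv
  obtain ⟨hv₁, hv₂, hv₃, rfl⟩ := hv
  have hB := patternPart_isSymm hA X
  refine ⟨patternPart A X, y, of R, p, ε', hpos, hPv,
    fun i j hij h => patternPart_apply_of_eq_zero X hij h, hB, sub_eq_zero.1 hv₁, ?_, ?_⟩
  · refine eq_of_isSymm_of_sub_add_antisymm ?_ isSymm_one hv₂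
    simp only [Matrix.IsSymm, transpose_mul, transpose_transpose, transpose_add, transpose_one,
      transpose_smul, transpose_vecMulVec, Matrix.mul_assoc]
  · refine eq_of_isSymm_of_sub_add_antisymm ?_ (hA.polyPerturb p) hv₃
    simp only [Matrix.IsSymm, transpose_mul, transpose_transpose, transpose_add, hB.eq,
      transpose_smul, transpose_vecMulVec, Matrix.mul_assoc, add_comm (vecMulVec y _)]

end Perturbation

section Nondegeneracy

variable {m : ℕ} {κ : Type*} [Fintype κ] [DecidableEq κ]

/-- The parameters `(B, y, R, p, ε)` of a reduction to `polyPerturb A p`. -/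
abbrev ReductionParams (m : ℕ) : Type :=
  Matrix (Fin m) (Fin m) ℝ × (Fin m → ℝ) × Matrix (Fin m) (Fin m) ℝ × (Fin m → ℝ) × ℝ

/-- Linear conditions on `X` implied by the commutation and trace equations in the SMP of the
bordered matrix, and depending continuously on the parameters, including at `ε = 0`. -/
noncomputable def smpDefect (J : Matrix κ (Fin m) ℝ) (w : κ → ℝ) (A : Matrix (Fin m) (Fin m) ℝ)
    (σ : Fin m → ℝ) (ℓ : Fin m) (v : ReductionParams m) (X : Matrix κ κ ℝ) :
    Matrix κ κ ℝ × Matrix (Fin m) (Fin m) ℝ × (Set.Ico 2 m → ℝ) :=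
  let B := v.1
  let y := v.2.1
  let ε := v.2.2.2.2
  let c := signedCol σ ℓ B
  let D := polyPerturb A v.2.2.2.1
  let W := invBasis J w y v.2.2.1 ε
  let M := ε • (J * B * Jᵀ + vecMulVec (J *ᵥ c) w + vecMulVec w (J *ᵥ c)) + vecMulVec w w
  (M * X - X * M,
    B * (Jᵀ * X * J) + vecMulVec c w * X * J - Jᵀ * X * J * B - Jᵀ * X * vecMulVec w c,
    fun k => (W * (D ^ (k : ℕ) * ((1 - ε ^ 2 * (c ⬝ᵥ y)) • 1 - ε • D)) * Wᵀ * X).trace)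

omit [DecidableEq κ] in
theorem continuous_smpDefect (J : Matrix κ (Fin m) ℝ) (w : κ → ℝ)
    (A : Matrix (Fin m) (Fin m) ℝ) (σ : Fin m → ℝ) (ℓ : Fin m) :
    Continuous fun z : ReductionParams m × Matrix κ κ ℝ =>
      smpDefect J w A σ ℓ z.1 z.2 := by
  have hc : Continuous fun z : ReductionParams m × Matrix κ κ ℝ => signedCol σ ℓ z.1.1 := by
    refine continuous_pi fun i => ?_
    exact continuous_const.mul (continuous_fst.fst.matrix_elem i ℓ)
  have hD : Continuous fun z : ReductionParams m × Matrix κ κ ℝ =>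
      polyPerturb A z.1.2.2.2.1 := by
    unfold polyPerturb
    fun_prop
  have hW : Continuous fun z : ReductionParams m × Matrix κ κ ℝ =>
      invBasis J w z.1.2.1 z.1.2.2.1 z.1.2.2.2.2 := by
    unfold invBasis
    fun_prop
  unfold smpDefect
  refine Continuous.prodMk ?_ (Continuous.prodMk ?_ ?_)
  · fun_prop
  · fun_prop
  · refine continuous_pi fun k => ?_
    fun_prop

omit [DecidableEq κ] in
theorem smpDefect_smul (J : Matrix κ (Fin m) ℝ) (w : κ → ℝ)
    (A : Matrix (Fin m) (Fin m) ℝ) (σ : Fin m → ℝ) (ℓ : Fin m) (v : ReductionParams m) (t : ℝ)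
    (X : Matrix κ κ ℝ) :
    smpDefect J w A σ ℓ v (t • X) = t • smpDefect J w A σ ℓ v X := by
  simp only [smpDefect, Matrix.mul_smul, Matrix.smul_mul, ← smul_sub, ← smul_add, Prod.smul_mk,
    trace_smul]
  rfl

namespace IsSplitting

variable {J : Matrix κ (Fin m) ℝ} {w : κ → ℝ}

theorem eq_zero_of_smpDefect_base (h : IsSplitting J w) {A : Matrix (Fin m) (Fin m) ℝ}
    (hsmp : HasSMP A) (σ : Fin m → ℝ) (ℓ : Fin m) {X : Matrix κ κ ℝ} (hX : X.IsSymm)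
    (hXw : w ⬝ᵥ X *ᵥ w = 0)
    (hpat : X *ᵥ w = 0 → ∀ a b, a = b ∨ A a b ≠ 0 → (Jᵀ * X * J) a b = 0)
    (hdef : smpDefect J w A σ ℓ (A, -signedCol σ ℓ A, 1, 0, 0) X = 0) : X = 0 := by
  simp only [smpDefect, Prod.mk_eq_zero] at hdef
  obtain ⟨h₁, h₂, h₃⟩ := hdef
  have hw : X *ᵥ w = 0 := by
    have := congrArg (· *ᵥ w) h₁
    simpa [sub_mulVec, ← mulVec_mulVec, vecMulVec_mulVec, hXw, h.dotProduct_self] using this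
  have hw' : w ᵥ* X = 0 := by rw [← mulVec_transpose, hX.eq, hw]
  have h₄ : Jᵀ * X * J = 0 := by
    apply hsmp
    · simp only [Matrix.IsSymm, transpose_mul, transpose_transpose, hX.eq, Matrix.mul_assoc]
    · exact hadamard_eq_zero_iff.2 fun a b hab => hpat hw a b (Or.inr hab)
    · refine hadamard_eq_zero_iff.2 fun a b hab => hpat hw a b (Or.inl ?_)
      by_contra hne
      exact hab (one_apply_ne hne)
    · rw [vecMulVec_mul, hw', Matrix.mul_assoc Jᵀ X (vecMulVec _ _), mul_vecMulVec, hw] at h₂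
      rw [← h₂]
      ext i j
      simp [vecMulVec_apply, Matrix.mul_apply]
    · intro k hk hkm
      have hk3 := congrFun h₃ ⟨k, hk, by omega⟩
      simp only [invBasis, polyPerturb, zero_smul, Matrix.mul_one, Pi.zero_apply,
        Finset.sum_const_zero, add_zero, one_smul, sub_zero, ne_eq, OfNat.ofNat_ne_zero,
        not_false_eq_true, zero_pow, zero_mul] at hk3
      rw [← hk3, Matrix.mul_assoc J, Matrix.mul_assoc J, trace_mul_comm J]
      simp only [Matrix.mul_assoc]
  calc X = (J * Jᵀ + vecMulVec w w) * X * (J * Jᵀ + vecMulVec w w) := by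
        rw [h.mul_transpose_add, Matrix.one_mul, Matrix.mul_one]
    _ = J * (Jᵀ * X * J) * Jᵀ := by
        rw [Matrix.mul_add, Matrix.mul_assoc _ X (vecMulVec _ _), mul_vecMulVec, hw,
          Matrix.add_mul, vecMulVec_mul, hw']
        have e1 : vecMulVec w (0 : κ → ℝ) = 0 := by ext i j; simp [vecMulVec_apply]
        have e2 : vecMulVec (0 : κ → ℝ) w = 0 := by ext i j; simp [vecMulVec_apply]
        rw [e1, e2, Matrix.mul_zero, add_zero, add_zero]
        simp only [Matrix.mul_assoc]
    _ = 0 := by rw [h₄, Matrix.mul_zero, Matrix.zero_mul]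

theorem eventually_smpDefect_ne_zero (h : IsSplitting J w) {A : Matrix (Fin m) (Fin m) ℝ}
    (hsmp : HasSMP A) (σ : Fin m → ℝ) (ℓ : Fin m) (V : Submodule ℝ (Matrix κ κ ℝ))
    (hV : ∀ X ∈ V, X.IsSymm ∧ w ⬝ᵥ X *ᵥ w = 0 ∧
      (X *ᵥ w = 0 → ∀ a b, a = b ∨ A a b ≠ 0 → (Jᵀ * X * J) a b = 0)) :
    ∀ᶠ v in 𝓝 (A, -signedCol σ ℓ A, 1, 0, 0), ∀ X ∈ V, smpDefect J w A σ ℓ v X = 0 → X = 0 := by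
  set K : Set (κ → κ → ℝ) := Metric.sphere 0 1 ∩ {X | of X ∈ V} with hK
  have hof : Continuous fun X : κ → κ → ℝ => (of X : Matrix κ κ ℝ) := continuous_id
  have hKc : IsCompact K := (isCompact_sphere 0 1).inter_right
    (V.closed_of_finiteDimensional.preimage hof)
  have hev : ∀ᶠ v in 𝓝 (A, -signedCol σ ℓ A, 1, 0, 0), ∀ X ∈ K,
      smpDefect J w A σ ℓ v (of X) ≠ 0 := by
    refine hKc.eventually_forall_of_forall_eventually fun X hX => ?_
    have hcont : Continuous fun z : ReductionParams m × (κ → κ → ℝ) =>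
        smpDefect J w A σ ℓ z.1 (of z.2) :=
      (continuous_smpDefect J w A σ ℓ).comp
        (continuous_fst.prodMk (hof.comp continuous_snd))
    refine hcont.continuousAt.eventually_ne fun h0 => ?_
    obtain ⟨h1, h2, h3⟩ := hV _ hX.2
    have hX0 : X = 0 := of.injective (h.eq_zero_of_smpDefect_base hsmp σ ℓ h1 h2 h3 h0)
    simp [hK, hX0] at hX
  filter_upwards [hev] with v hv X hX hXv
  by_contra hne
  have hne' : of.symm X ≠ 0 := hne
  refine hv (‖of.symm X‖⁻¹ • of.symm X) ⟨?_, V.smul_mem _ hX⟩ ?_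
  · simp [norm_smul, hne']
  · change smpDefect J w A σ ℓ v (‖of.symm X‖⁻¹ • X) = 0
    rw [smpDefect_smul, hXv, smul_zero]

/-- The commutation and trace equations for the bordered matrix imply `smpDefect = 0`. -/
theorem smpDefect_eq_zero (h : IsSplitting J w) {A B R : Matrix (Fin m) (Fin m) ℝ}
    {y p : Fin m → ℝ} {ε : ℝ} {σ : Fin m → ℝ} {ℓ : Fin m} (hε : ε ≠ 0)
    (hr : IsReduction B (signedCol σ ℓ B) y R (polyPerturb A p) ε) {X : Matrix κ κ ℝ}
    (hcomm : bordered J w B (signedCol σ ℓ B) ε * X = X * bordered J w B (signedCol σ ℓ B) ε)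
    (htr : ∀ k, 2 ≤ k → k ≤ m → (bordered J w B (signedCol σ ℓ B) ε ^ k * X).trace = 0) :
    smpDefect J w A σ ℓ (B, y, R, p, ε) X = 0 := by
  simp only [smpDefect]
  set c := signedCol σ ℓ B
  refine Prod.ext ?_ (Prod.ext ?_ ?_)
  · have hM : ε • (J * B * Jᵀ + vecMulVec (J *ᵥ c) w + vecMulVec w (J *ᵥ c)) + vecMulVec w w =
        ε • bordered J w B c ε := by
      rw [bordered, smul_add ε _ (ε⁻¹ • vecMulVec w w), smul_smul, mul_inv_cancel₀ hε, one_smul]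
    simp only [hM, Matrix.smul_mul, Matrix.mul_smul, hcomm, sub_self, Prod.fst_zero]
  · have h1 := h.bordered_mul (B := B) (c := c) (ε := ε)
    have h2 : Jᵀ * bordered J w B c ε = B * Jᵀ + vecMulVec c w := by
      have := congrArg transpose h1
      rwa [transpose_mul, (bordered_isSymm hr.isSymm).eq, transpose_add, transpose_mul,
        hr.isSymm.eq, transpose_vecMulVec] at this
    have h3 : Jᵀ * bordered J w B c ε * X * J = Jᵀ * X * (bordered J w B c ε * J) := by
      rw [Matrix.mul_assoc Jᵀ, hcomm]
      simp only [Matrix.mul_assoc]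
    rw [h1, h2] at h3
    simp only [Matrix.add_mul, Matrix.mul_add] at h3
    simp only [← Matrix.mul_assoc] at h3 ⊢
    simp only [Prod.snd_zero, Prod.fst_zero]
    rw [h3]
    abel
  · funext k
    obtain ⟨k, hk⟩ := k
    change (invBasis J w y R ε * (polyPerturb A p ^ k * ((1 - ε ^ 2 * (c ⬝ᵥ y)) • 1 -
      ε • polyPerturb A p)) * (invBasis J w y R ε)ᵀ * X).trace = 0
    rw [← h.bordered_pow_mul_deflation hr hε k, Matrix.mul_sub, Matrix.mul_smul, Matrix.mul_smul,
      Matrix.mul_one, ← pow_succ, Matrix.sub_mul, Matrix.smul_mul, Matrix.smul_mul, trace_sub,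
      trace_smul, trace_smul, htr k hk.1 hk.2.le, htr (k + 1) (hk.1.trans k.le_succ) hk.2,
      smul_zero, smul_zero, sub_zero]

end IsSplitting

end Nondegeneracy

section Spectrum

variable {m : ℕ} {κ : Type*} [Fintype κ] [DecidableEq κ]

/-- The eigenvalue of `polyPerturb A p` corresponding to the eigenvalue `t` of `A`. -/
noncomputable def perturbEigenvalue (p : Fin m → ℝ) (t : ℝ) : ℝ :=
  t + ∑ k, p k * t ^ (k : ℕ)

theorem polyPerturb_mul_of_mul_eq {A U : Matrix (Fin m) (Fin m) ℝ} {d : Fin m → ℝ}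
    (hAU : A * U = U * diagonal d) (p : Fin m → ℝ) :
    polyPerturb A p * U = U * diagonal fun i => perturbEigenvalue p (d i) := by
  have hpow : ∀ k : ℕ, A ^ k * U = U * diagonal fun i => d i ^ k := by
    intro k
    induction k with
    | zero => simp
    | succ k ih =>
      rw [pow_succ', Matrix.mul_assoc, ih, ← Matrix.mul_assoc, hAU, Matrix.mul_assoc,
        diagonal_mul_diagonal]
      simp only [pow_succ']
  rw [polyPerturb, Matrix.add_mul, Matrix.sum_mul, hAU]
  simp only [Matrix.smul_mul, hpow]
  ext i j
  simp only [Matrix.add_apply, Matrix.sum_apply, Matrix.smul_apply, mul_diagonal, smul_eq_mul,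
    perturbEigenvalue, mul_add, Finset.mul_sum]
  congr 1
  exact Finset.sum_congr rfl fun k _ => by ring

/-- If the perturbed eigenvalues of `A` stay in order and below the extra eigenvalue, the bordered
matrix has the ordered multiplicity list of `A` with a `1` appended. -/
theorem IsSplitting.exists_ordered_eigenvalues {J : Matrix κ (Fin m) ℝ} {w : κ → ℝ}
    (h : IsSplitting J w) {A B R : Matrix (Fin m) (Fin m) ℝ} (hA : A.IsSymm)
    {c y p : Fin m → ℝ} {ε : ℝ} (hε : ε ≠ 0) (hr : IsReduction B c y R (polyPerturb A p) ε)
    {q : ℕ} {μ : Fin q → ℝ}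
    (hμall : ∀ t : ℝ, 1 ≤ multOf A t → ∃ i, t = μ i)
    (hmono : StrictMono fun i => perturbEigenvalue p (μ i))
    (hlt : ∀ i, perturbEigenvalue p (μ i) < ε⁻¹ - ε * (c ⬝ᵥ y)) :
    ∃ ν : Fin (q + 1) → ℝ, StrictMono ν ∧
      (∀ t : ℝ, 1 ≤ multOf (bordered J w B c ε) t → ∃ i, t = ν i) ∧
      (∀ i : Fin q, multOf (bordered J w B c ε) (ν i.castSucc) = multOf A (μ i)) ∧
      multOf (bordered J w B c ε) (ν (Fin.last q)) = 1 := by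
  obtain ⟨U, d, hU, hAU⟩ := hA.exists_orthogonal_diagonalization
  have hmA := multOf_eq_card hU (mul_eq_one_comm.1 hU) hAU
  obtain ⟨Q, Q', hQ, hQ', hBQ⟩ := h.exists_diagonalization hr hε hU
    (polyPerturb_mul_of_mul_eq hAU p)
  have hmB := multOf_eq_card hQ hQ' hBQ
  set L := ε⁻¹ - ε * (c ⬝ᵥ y)
  have hd : ∀ j, ∃ i, d j = μ i := fun j => hμall _ <| by
    rw [hmA, Nat.one_le_iff_ne_zero, ← Nat.pos_iff_ne_zero, Fintype.card_pos_iff]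
    exact ⟨⟨j, rfl⟩⟩
  have hdL : ∀ j, perturbEigenvalue p (d j) ≠ L := by
    intro j
    obtain ⟨i, hi⟩ := hd j
    rw [hi]
    exact (hlt i).ne
  refine ⟨Fin.snoc (fun i => perturbEigenvalue p (μ i)) L, ?_, ?_, ?_, ?_⟩
  · intro i j hij
    induction j using Fin.lastCases with
    | last =>
      induction i using Fin.lastCases with
      | last => exact absurd hij (lt_irrefl _)
      | cast i => simpa using hlt i
    | cast j =>
      induction i using Fin.lastCases with
      | last => exact absurd hij (Fin.castSucc_lt_last j).not_gt
      | cast i => simpa using hmono (Fin.castSucc_lt_castSucc_iff.1 hij)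
  · intro t ht
    rw [hmB, Nat.one_le_iff_ne_zero, ← Nat.pos_iff_ne_zero, Fintype.card_pos_iff] at ht
    obtain ⟨⟨j | j, hj⟩⟩ := ht
    · obtain ⟨i, hi⟩ := hd j
      exact ⟨i.castSucc, by simpa [hi] using hj.symm⟩
    · exact ⟨Fin.last q, by simpa using hj.symm⟩
  · intro i
    rw [hmB, hmA, Fin.snoc_castSucc]
    refine (Fintype.card_congr (Equiv.ofBijective
      (fun j => ⟨Sum.inl j.1, by simp [j.2]⟩) ⟨?_, ?_⟩)).symm
    · intro j j' hjj
      simpa [Subtype.ext_iff] using hjj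
    · rintro ⟨j | j, hj⟩
      · obtain ⟨i', hi'⟩ := hd j
        simp only [Sum.elim_inl, hi'] at hj
        exact ⟨⟨j, hi'.trans (congrArg μ (hmono.injective hj))⟩, rfl⟩
      · exact absurd hj.symm (hlt i).ne
  · rw [hmB, Fin.snoc_last, Fintype.card_eq_one_iff]
    refine ⟨⟨Sum.inr (), rfl⟩, ?_⟩
    rintro ⟨j | j, hj⟩
    · exact absurd hj (hdL j)
    · rfl

end Spectrum

section Decontraction

variable {n : ℕ}

/-- The contraction of the edge between the two last vertices. -/
def contractMap : Fin (n + 2) → Fin (n + 1) :=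
  Fin.lastCases (Fin.last n) id

/-- The normalizing coefficients of the splitting. -/
noncomputable def splitCoeff (a : Fin (n + 1)) : ℝ :=
  if a = Fin.last n then (√2)⁻¹ else 1

/-- The isometry replacing the last basis vector by the normalized sum of two. -/
noncomputable def splitMatrix (n : ℕ) : Matrix (Fin (n + 2)) (Fin (n + 1)) ℝ :=
  of fun i a => if contractMap i = a then splitCoeff a else 0

/-- The normalized difference of the two last basis vectors. -/
noncomputable def splitVec (n : ℕ) : Fin (n + 2) → ℝ :=
  Fin.lastCases (-(√2)⁻¹) fun a => if a = Fin.last n then (√2)⁻¹ else 0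

@[simp]
theorem contractMap_last : contractMap (Fin.last (n + 1)) = Fin.last n := by
  simp [contractMap]

@[simp]
theorem contractMap_castSucc (a : Fin (n + 1)) : contractMap a.castSucc = a := by
  simp [contractMap]

@[simp]
theorem splitVec_last : splitVec n (Fin.last (n + 1)) = -(√2)⁻¹ := by
  simp [splitVec]

@[simp]
theorem splitVec_castSucc (a : Fin (n + 1)) :
    splitVec n a.castSucc = if a = Fin.last n then (√2)⁻¹ else 0 := by
  simp [splitVec]

theorem inv_sqrt_two_mul_self : (√2 : ℝ)⁻¹ * (√2)⁻¹ = 2⁻¹ := by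
  rw [← mul_inv, Real.mul_self_sqrt zero_le_two]

theorem splitMatrix_mul_transpose_apply (i j : Fin (n + 2)) :
    (splitMatrix n * (splitMatrix n)ᵀ) i j =
      if contractMap i = contractMap j then
        splitCoeff (contractMap i) * splitCoeff (contractMap i) else 0 := by
  simp only [splitMatrix, Matrix.mul_apply, of_apply, transpose_apply, mul_ite, ite_mul, zero_mul,
    mul_zero, Finset.sum_ite_eq, Finset.mem_univ, if_true]
  split_ifs with h <;> simp [h]

theorem isSplitting_splitMatrix : IsSplitting (splitMatrix n) (splitVec n) where
  transpose_mul_self := by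
    ext a b
    rw [Matrix.mul_apply, Fin.sum_univ_castSucc]
    by_cases hab : a = b
    · subst hab
      by_cases ha : Fin.last n = a
      · subst ha
        simp [splitMatrix, splitCoeff, inv_sqrt_two_mul_self]
        norm_num
      · simp [splitMatrix, splitCoeff, ha, Ne.symm ha]
    · have : ∀ x : Fin (n + 1), x = a → x = b → False := fun x h1 h2 => hab (h1.symm.trans h2)
      simp [splitMatrix, hab]
      grind
  transpose_mulVec := by
    ext a
    rw [mulVec, dotProduct, Fin.sum_univ_castSucc]
    by_cases ha : Fin.last n = a
    · subst ha
      simp [splitMatrix]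
    · simp [splitMatrix, ha]
  dotProduct_self := by
    rw [dotProduct, Fin.sum_univ_castSucc]
    simp [inv_sqrt_two_mul_self]
    norm_num
  mul_transpose_add := by
    ext i j
    rw [Matrix.add_apply, splitMatrix_mul_transpose_apply, vecMulVec_apply]
    induction i using Fin.lastCases with
    | last =>
      induction j using Fin.lastCases with
      | last =>
        simp [splitCoeff, inv_sqrt_two_mul_self]
        norm_num
      | cast j =>
        by_cases hj : Fin.last n = j
        · subst hj
          simp [splitCoeff, one_apply, (Fin.castSucc_ne_last _).symm]
        · simp [hj, Ne.symm hj, one_apply, (Fin.castSucc_ne_last _).symm]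
    | cast i =>
      induction j using Fin.lastCases with
      | last =>
        by_cases hi : i = Fin.last n
        · subst hi
          simp [splitCoeff, one_apply, Fin.castSucc_ne_last]
        · simp [hi, one_apply, Fin.castSucc_ne_last]
      | cast j =>
        by_cases hij : i = j
        · subst hij
          by_cases hi : i = Fin.last n
          · subst hi
            simp [splitCoeff, inv_sqrt_two_mul_self]
            norm_num
          · simp [splitCoeff, hi]
        · simp [hij, one_apply]
          grind

theorem splitMatrix_mulVec (c : Fin (n + 1) → ℝ) (i : Fin (n + 2)) :
    (splitMatrix n *ᵥ c) i = splitCoeff (contractMap i) * c (contractMap i) := by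
  simp [splitMatrix, mulVec, dotProduct]

theorem bordered_splitMatrix_apply (B : Matrix (Fin (n + 1)) (Fin (n + 1)) ℝ)
    (c : Fin (n + 1) → ℝ) (ε : ℝ) (i j : Fin (n + 2)) :
    bordered (splitMatrix n) (splitVec n) B c ε i j =
      splitCoeff (contractMap i) * splitCoeff (contractMap j) * B (contractMap i) (contractMap j) +
        splitCoeff (contractMap i) * c (contractMap i) * splitVec n j +
        splitVec n i * (splitCoeff (contractMap j) * c (contractMap j)) +
        ε⁻¹ * (splitVec n i * splitVec n j) := by
  simp only [bordered, Matrix.add_apply, Matrix.smul_apply, vecMulVec_apply, splitMatrix_mulVec,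
    smul_eq_mul]
  congr 3
  simp [splitMatrix, Matrix.mul_apply]
  ring

section Adjacency

variable {G : SimpleGraph (Fin (n + 1))} {α β : Set (Fin (n + 1))}

theorem decontract_adj_castSucc {a b : Fin (n + 1)} (ha : a ≠ Fin.last n) (hb : b ≠ Fin.last n) :
    (decontract G α β).Adj a.castSucc b.castSucc ↔ G.Adj a b := by
  have := G.ne_of_adj (a := a) (b := b)
  simp [decontract, ha, hb, Fin.castSucc_ne_last, G.adj_comm b a]
  grind

theorem decontract_adj_castSucc_last {a : Fin (n + 1)} (ha : a ≠ Fin.last n) :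
    (decontract G α β).Adj a.castSucc (Fin.last n).castSucc ↔ a ∈ α := by
  simp [decontract, ha, Fin.castSucc_ne_last]

theorem decontract_adj_last {a : Fin (n + 1)} (ha : a ≠ Fin.last n) :
    (decontract G α β).Adj a.castSucc (Fin.last (n + 1)) ↔ a ∈ β := by
  simp [decontract, ha, (Fin.castSucc_ne_last _).symm, Fin.castSucc_ne_last]

theorem decontract_adj_last_last :
    (decontract G α β).Adj (Fin.last n).castSucc (Fin.last (n + 1)) := by
  simp [decontract, Fin.castSucc_ne_last]


open Classical in
/-- The signs distinguishing the two parts of the neighborhood of the split vertex. -/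
noncomputable def partSign (α β : Set (Fin (n + 1))) (a : Fin (n + 1)) : ℝ :=
  if a ∈ α then 1 else if a ∈ β then -1 else 0

theorem inS_bordered_splitMatrix {A B : Matrix (Fin (n + 1)) (Fin (n + 1)) ℝ} (hA : InS G A)
    (hB : B.IsSymm) (hAB : ∀ i j, i ≠ j → (B i j ≠ 0 ↔ A i j ≠ 0))
    (hpart : α ∪ β = G.neighborSet (Fin.last n)) (hdisj : Disjoint α β) {ε : ℝ} (hε : ε ≠ 0)
    (hBε : ε * B (Fin.last n) (Fin.last n) ≠ 1) :
    InS (decontract G α β) (bordered (splitMatrix n) (splitVec n) B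
      (signedCol (partSign α β) (Fin.last n) B) ε) := by
  have hr : ((√2)⁻¹ : ℝ) ≠ 0 := by positivity
  have hBG : ∀ i j, i ≠ j → (B i j ≠ 0 ↔ G.Adj i j) := fun i j hij =>
    (hAB i j hij).trans (hA.2 i j hij)
  have hnbr : ∀ a, a ∈ α ∨ a ∈ β ↔ G.Adj a (Fin.last n) := fun a => by
    rw [← Set.mem_union, hpart, SimpleGraph.mem_neighborSet, G.adj_comm]
  have hne : ∀ a, a ∈ α → a ∉ β := fun a h h' => Set.disjoint_left.1 hdisj h h'
  have hsymm := bordered_isSymm (J := splitMatrix n) (w := splitVec n)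
    (c := signedCol (partSign α β) (Fin.last n) B) (ε := ε) hB
  have hlast : partSign α β (Fin.last n) = 0 := by
    have h1 : Fin.last n ∉ α := fun h => G.irrefl ((hnbr _).1 (Or.inl h))
    have h2 : Fin.last n ∉ β := fun h => G.irrefl ((hnbr _).1 (Or.inr h))
    simp [partSign, h1, h2]
  refine ⟨hsymm, ?_⟩
  suffices H : ∀ i j : Fin (n + 2), i < j → (bordered (splitMatrix n) (splitVec n) B
      (signedCol (partSign α β) (Fin.last n) B) ε i j ≠ 0 ↔ (decontract G α β).Adj i j) by
    intro i j hij
    rcases hij.lt_or_gt with h | h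
    · exact H i j h
    · rw [← hsymm.apply, SimpleGraph.adj_comm]
      exact H j i h
  intro i j hij
  rw [bordered_splitMatrix_apply]
  induction i using Fin.lastCases with
  | last => exact absurd hij (Fin.le_last j).not_gt
  | cast a =>
    induction j using Fin.lastCases with
    | last =>
      by_cases ha : a = Fin.last n
      · subst ha
        simp only [decontract_adj_last_last, iff_true, contractMap_castSucc, contractMap_last,
          splitCoeff, splitVec_castSucc, splitVec_last, if_true, signedCol, hlast]
        have h1 : (B (Fin.last n) (Fin.last n) - ε⁻¹) ≠ 0 := by
          rw [sub_ne_zero]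
          rintro h
          rw [h, mul_inv_cancel₀ hε] at hBε
          exact hBε rfl
        convert mul_ne_zero (mul_ne_zero hr hr) h1 using 1
        ring
      · rw [decontract_adj_last ha]
        have h1 := hBG a (Fin.last n) ha
        rw [← hnbr] at h1
        simp only [contractMap_castSucc, contractMap_last, splitCoeff, splitVec_castSucc,
          splitVec_last, if_true, if_neg ha, signedCol]
        have h2 : 1 * (√2)⁻¹ * B a (Fin.last n) +
            1 * (partSign α β a * B a (Fin.last n)) * -(√2)⁻¹ +
            0 * ((√2)⁻¹ * (partSign α β (Fin.last n) * B (Fin.last n) (Fin.last n))) +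
            ε⁻¹ * (0 * -(√2)⁻¹) = (√2)⁻¹ * B a (Fin.last n) * (1 - partSign α β a) := by ring
        rw [h2]
        by_cases haα : a ∈ α
        · simp [partSign, haα, hne a haα]
        · by_cases haβ : a ∈ β
          · simp only [haβ, or_true, iff_true] at h1 ⊢
            refine mul_ne_zero (mul_ne_zero hr h1) ?_
            norm_num [partSign, haα, haβ]
          · simp only [haα, haβ, or_self, iff_false, not_not] at h1 ⊢
            simp [h1]
    | cast b =>
      have ha : a ≠ Fin.last n :=
        ((Fin.castSucc_lt_castSucc_iff.1 hij).trans_le (Fin.le_last b)).ne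
      by_cases hb : b = Fin.last n
      · subst hb
        rw [decontract_adj_castSucc_last ha]
        have h1 := hBG a (Fin.last n) ha
        rw [← hnbr] at h1
        simp only [contractMap_castSucc, splitCoeff, splitVec_castSucc, if_true, if_neg ha,
          signedCol]
        have h2 : 1 * (√2)⁻¹ * B a (Fin.last n) +
            1 * (partSign α β a * B a (Fin.last n)) * (√2)⁻¹ +
            0 * ((√2)⁻¹ * (partSign α β (Fin.last n) * B (Fin.last n) (Fin.last n))) +
            ε⁻¹ * (0 * (√2)⁻¹) = (√2)⁻¹ * B a (Fin.last n) * (1 + partSign α β a) := by ring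
        rw [h2]
        by_cases haα : a ∈ α
        · simp only [haα, true_or, iff_true] at h1 ⊢
          refine mul_ne_zero (mul_ne_zero hr h1) ?_
          norm_num [partSign, haα]
        · by_cases haβ : a ∈ β
          · simp [partSign, haα, haβ]
          · simp only [haα, haβ, or_self, iff_false, not_not] at h1 ⊢
            simp [h1]
      · rw [decontract_adj_castSucc ha hb, ← hBG a b fun h => hij.ne (congrArg _ h)]
        simp [splitCoeff, ha, hb]

/-- The symmetric matrices vanishing on the diagonal and on the edges of `H`. -/
def complementSubmodule {m : ℕ} (H : SimpleGraph (Fin m)) :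
    Submodule ℝ (Matrix (Fin m) (Fin m) ℝ) where
  carrier := {X | X.IsSymm ∧ ∀ i j, i = j ∨ H.Adj i j → X i j = 0}
  add_mem' hX hY := ⟨hX.1.add hY.1, fun i j h => by simp [hX.2 i j h, hY.2 i j h]⟩
  zero_mem' := ⟨isSymm_zero, fun _ _ _ => rfl⟩
  smul_mem' t _ hX := ⟨hX.1.smul t, fun i j h => by simp [hX.2 i j h]⟩

theorem dotProduct_mulVec_splitVec {X : Matrix (Fin (n + 2)) (Fin (n + 2)) ℝ}
    (hX : X ∈ complementSubmodule (decontract G α β)) :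
    splitVec n ⬝ᵥ X *ᵥ splitVec n = 0 := by
  have h1 := hX.2 (Fin.last n).castSucc _ (Or.inl rfl)
  have h2 := hX.2 (Fin.last (n + 1)) _ (Or.inl rfl)
  have h3 := hX.2 (Fin.last n).castSucc (Fin.last (n + 1)) (Or.inr decontract_adj_last_last)
  have h4 := (hX.1.apply _ _).trans h3
  simp [dotProduct, mulVec, Fin.sum_univ_castSucc (n := n + 1), h1, h2, h3, h4]

theorem compression_apply_eq_zero {A : Matrix (Fin (n + 1)) (Fin (n + 1)) ℝ} (hA : InS G A)
    (hpart : α ∪ β = G.neighborSet (Fin.last n)) {X : Matrix (Fin (n + 2)) (Fin (n + 2)) ℝ}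
    (hX : X ∈ complementSubmodule (decontract G α β)) (hw : X *ᵥ splitVec n = 0)
    {a b : Fin (n + 1)} (hab : a = b ∨ A a b ≠ 0) :
    ((splitMatrix n)ᵀ * X * splitMatrix n) a b = 0 := by
  have hr : ((√2)⁻¹ : ℝ) ≠ 0 := by positivity
  obtain ⟨hXs, hX⟩ := hX
  have hcol : ∀ i, X i (Fin.last n).castSucc = X i (Fin.last (n + 1)) := by
    intro i
    have := congrFun hw i
    simp only [mulVec, dotProduct, Fin.sum_univ_castSucc (n := n + 1), splitVec_castSucc,
      splitVec_last, mul_ite, mul_zero, Finset.sum_ite_eq', Finset.mem_univ, if_true,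
      Pi.zero_apply] at this
    refine mul_right_cancel₀ hr ?_
    linarith
  have hlast : ∀ a, G.Adj a (Fin.last n) →
      X a.castSucc (Fin.last n).castSucc = 0 ∧ X a.castSucc (Fin.last (n + 1)) = 0 := by
    intro a ha
    rw [hcol, and_self]
    have hne := G.ne_of_adj ha
    have : a ∈ α ∪ β := by rwa [hpart, SimpleGraph.mem_neighborSet, G.adj_comm]
    rcases this with h | h
    · rw [← hcol]
      exact hX _ _ (Or.inr ((decontract_adj_castSucc_last hne).2 h))
    · exact hX _ _ (Or.inr ((decontract_adj_last hne).2 h))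
  have hll := hX _ _ (Or.inr (decontract_adj_last_last (G := G) (α := α) (β := β)))
  have key : ∀ i j, contractMap i = contractMap j ∨ G.Adj (contractMap i) (contractMap j) →
      X i j = 0 := by
    intro i j hij
    induction i using Fin.lastCases with
    | last =>
      induction j using Fin.lastCases with
      | last => exact hX _ _ (Or.inl rfl)
      | cast b =>
        rw [hXs.apply]
        simp only [contractMap_last, contractMap_castSucc] at hij
        rcases hij with rfl | h
        · exact hll
        · exact (hlast b h.symm).2
    | cast a =>
      induction j using Fin.lastCases with
      | last =>
        simp only [contractMap_last, contractMap_castSucc] at hij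
        rcases hij with rfl | h
        · exact hll
        · exact (hlast a h).2
      | cast b =>
        simp only [contractMap_castSucc] at hij
        rcases hij with rfl | h
        · exact hX _ _ (Or.inl rfl)
        · by_cases hb : b = Fin.last n
          · subst hb
            exact (hlast a h).1
          · by_cases ha : a = Fin.last n
            · subst ha
              rw [hXs.apply]
              exact (hlast b h.symm).1
            · exact hX _ _ (Or.inr ((decontract_adj_castSucc ha hb).2 h))
  have hGab : a = b ∨ G.Adj a b := by
    by_cases h : a = b
    · exact Or.inl h
    · exact Or.inr ((hA.2 a b h).1 (hab.resolve_left h))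
  simp only [Matrix.mul_apply, Finset.sum_mul]
  refine Finset.sum_eq_zero fun j _ => Finset.sum_eq_zero fun i _ => ?_
  simp only [splitMatrix, transpose_apply, of_apply]
  split_ifs with hi hj <;> try simp
  subst hi hj
  simp [key _ _ hGab]

end Adjacency

end Decontraction

section Openness

variable {m : ℕ}

theorem eventually_pattern (A : Matrix (Fin m) (Fin m) ℝ) (σ : Fin m → ℝ) (ℓ : Fin m) :
    ∀ᶠ v : ReductionParams m in 𝓝 (A, -signedCol σ ℓ A, 1, 0, 0),
      (∀ i j, A i j ≠ 0 → v.1 i j ≠ 0) ∧ v.2.2.2.2 * v.1 ℓ ℓ ≠ 1 := by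
  refine Filter.Eventually.and ?_ ?_
  · refine Filter.eventually_all.2 fun i => Filter.eventually_all.2 fun j => ?_
    by_cases h : A i j = 0
    · simp [h]
    · have hc : Continuous fun v : ReductionParams m => v.1 i j := continuous_fst.matrix_elem i j
      exact (hc.continuousAt.eventually_ne h).mono fun _ hv _ => hv
  · have hc : Continuous fun v : ReductionParams m => v.2.2.2.2 * v.1 ℓ ℓ :=
      (by fun_prop : Continuous fun v : ReductionParams m => v.2.2.2.2).mul
        (continuous_fst.matrix_elem ℓ ℓ)
    exact hc.continuousAt.eventually_ne (by simp)

theorem eventually_ordered (A : Matrix (Fin m) (Fin m) ℝ) (σ : Fin m → ℝ) (ℓ : Fin m) {q : ℕ}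
    {μ : Fin q → ℝ} (hμ : StrictMono μ) :
    ∀ᶠ v : ReductionParams m in 𝓝 (A, -signedCol σ ℓ A, 1, 0, 0),
      StrictMono (fun i => perturbEigenvalue v.2.2.2.1 (μ i)) ∧
      ∀ i, v.2.2.2.2 * perturbEigenvalue v.2.2.2.1 (μ i) <
        1 - v.2.2.2.2 ^ 2 * (signedCol σ ℓ v.1 ⬝ᵥ v.2.1) := by
  have hp : ∀ t, Continuous fun v : ReductionParams m => perturbEigenvalue v.2.2.2.1 t := by
    intro t
    unfold perturbEigenvalue
    fun_prop
  have hc : Continuous fun v : ReductionParams m => signedCol σ ℓ v.1 :=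
    continuous_pi fun i => continuous_const.mul (continuous_fst.matrix_elem i ℓ)
  refine Filter.Eventually.and ?_ ?_
  · refine Filter.eventually_all.2 fun i => Filter.eventually_all.2 fun j => ?_
    by_cases hij : i < j
    · refine ((hp (μ i)).continuousAt.eventually_lt (hp (μ j)).continuousAt ?_).mono
        fun _ hv _ => hv
      simpa [perturbEigenvalue] using hμ hij
    · exact Filter.Eventually.of_forall fun _ h => absurd h hij
  · refine Filter.eventually_all.2 fun i => ?_
    have hε : Continuous fun v : ReductionParams m => v.2.2.2.2 := by fun_prop
    refine (hε.mul (hp (μ i))).continuousAt.eventually_lt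
      (continuous_const.sub ((hε.pow 2).mul (hc.dotProduct
        (by fun_prop : Continuous fun v : ReductionParams m => v.2.1)))).continuousAt ?_
    simp

end Openness

/-- Decontraction Lemma for the SMP: if `A ∈ S(G)` has the SMP, whose distinct
eigenvalues are `μ 0 < ⋯ < μ (q-1)`, and `N_G(n) = α ⊔ β`, then there is an SMP
matrix `A' ∈ S(H)` whose ordered multiplicity list is that of `A` with a `1`
appended at the end, where `H` is the decontraction of `G` along the partition. -/
theorem decontraction_SMP {n : ℕ} (G : SimpleGraph (Fin (n + 1)))
    (A : Matrix (Fin (n + 1)) (Fin (n + 1)) ℝ) (hA : InS G A) (hsmp : HasSMP A)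
    (α β : Set (Fin (n + 1)))
    (hpart : α ∪ β = G.neighborSet (Fin.last n)) (hdisj : Disjoint α β)
    (q : ℕ) (μ : Fin q → ℝ) (hμmono : StrictMono μ)
    (hμeig : ∀ i, 1 ≤ multOf A (μ i))
    (hμall : ∀ t : ℝ, 1 ≤ multOf A t → ∃ i, t = μ i) :
    ∃ A' : Matrix (Fin (n + 2)) (Fin (n + 2)) ℝ,
      InS (decontract G α β) A' ∧ HasSMP A' ∧
      ∃ ν : Fin (q + 1) → ℝ, StrictMono ν ∧
        (∀ t : ℝ, 1 ≤ multOf A' t → ∃ i, t = ν i) ∧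
        (∀ i : Fin q, multOf A' (ν i.castSucc) = multOf A (μ i)) ∧
        multOf A' (ν (Fin.last q)) = 1 := by
  have hsplit := isSplitting_splitMatrix (n := n)
  obtain ⟨B, y, R, p, ε, hpos, ⟨⟨⟨hBA, hBε⟩, hmono, hlt⟩, hnd⟩, hzero, hr⟩ :=
    exists_isReduction hA.1 hsmp (partSign α β) (Fin.last n)
      (((eventually_pattern A (partSign α β) (Fin.last n)).and
        (eventually_ordered A (partSign α β) (Fin.last n) hμmono)).and
        (hsplit.eventually_smpDefect_ne_zero hsmp (partSign α β) (Fin.last n)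
          (complementSubmodule (decontract G α β)) fun X hX => ⟨hX.1, dotProduct_mulVec_splitVec hX,
            fun hw a b hab => compression_apply_eq_zero hA hpart hX hw hab⟩))
  have hA' := inS_bordered_splitMatrix hA hr.isSymm
    (fun i j hij => ⟨fun h h0 => h (hzero i j hij h0), hBA i j⟩) hpart hdisj hpos.ne' hBε
  refine ⟨_, hA', ?_, hsplit.exists_ordered_eigenvalues hA.1 hpos.ne' hr hμall hmono fun i => ?_⟩
  · intro X hX hAX h1X hcomm htr
    refine hnd X ⟨hX, fun i j hij => ?_⟩ (hsplit.smpDefect_eq_zero hpos.ne' hr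
      (sub_eq_zero.1 hcomm) htr)
    by_cases h : i = j
    · exact hadamard_eq_zero_iff.1 h1X i j (h ▸ by simp)
    · exact hadamard_eq_zero_iff.1 hAX i j ((hA'.2 i j h).2 (hij.resolve_left h))
  · rw [← mul_lt_mul_iff_right₀ hpos, mul_sub, mul_inv_cancel₀ hpos.ne', ← mul_assoc, ← sq]
    exact hlt i
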